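/- arXiv:1901.07793 — 9 statements merged into one kernel-verified Lean document; each statement's English description precedes it below -/
import Mathlib

section
/- Let K and Q be positive integers with Q ≤ K. Then the sequence Z_K^Q is strictly decreasing on [K−Q+1, K]: for every integer u with K−Q+1 ≤ u ≤ K−1, one has Z_K^Q(u+1) < Z_K^Q(u). -/
/-- The rational sequence `Z_K^Q(u)` from the paper:
`Z_K^Q(u) = ∑_{l=u+Q−K}^{min(u,Q)} ((Q−l)/(Q·l))·C(u,l)·C(K−u,Q−l)`. -/
def Z (K Q u : ℕ) : ℚ :=
  ∑ l ∈ Finset.Icc (u + Q - K) (min u Q),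
    (((Q : ℚ) - (l : ℚ)) / ((Q : ℚ) * (l : ℚ))) * (u.choose l : ℚ) *
      ((K - u).choose (Q - l) : ℚ)

/-- The terms outside the summation range of `Z` vanish, so the sum may run over all `l ≤ Q`. -/
theorem Z_eq_sum_range (K Q u : ℕ) (hu : u ≤ K) :
    Z K Q u = ∑ l ∈ Finset.range (Q + 1),
      (((Q : ℚ) - (l : ℚ)) / ((Q : ℚ) * (l : ℚ))) * (u.choose l : ℚ) *
        ((K - u).choose (Q - l) : ℚ) := by
  unfold Z
  apply Finset.sum_subset
  · intro l hl
    simp only [Finset.mem_Icc, Finset.mem_range] at *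
    omega
  · intro l hl hl'
    simp only [Finset.mem_Icc, Finset.mem_range] at *
    by_cases h : u < l
    · simp [Nat.choose_eq_zero_of_lt h]
    · have h' : K - u < Q - l := by omega
      simp [Nat.choose_eq_zero_of_lt h']

/-- Summation by parts for Vandermonde-type sums with weights vanishing at both ends. -/
theorem sum_choose_mul_choose_sub (f : ℕ → ℚ) (u n q : ℕ) (h0 : f 0 = 0) (hq : f (q + 1) = 0) :
    ∑ l ∈ Finset.range (q + 2), f l * (u.choose l : ℚ) * ((n + 1).choose (q + 1 - l) : ℚ) -
      ∑ l ∈ Finset.range (q + 2), f l * ((u + 1).choose l : ℚ) * (n.choose (q + 1 - l) : ℚ) =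
    ∑ l ∈ Finset.range (q + 1), (f l - f (l + 1)) * (u.choose l : ℚ) * (n.choose (q - l) : ℚ) := by
  have h1 : ∑ l ∈ Finset.range (q + 2),
        f l * (u.choose l : ℚ) * ((n + 1).choose (q + 1 - l) : ℚ) =
      ∑ l ∈ Finset.range (q + 1), f l * (u.choose l : ℚ) * (n.choose (q - l) : ℚ) +
      ∑ l ∈ Finset.range (q + 1), f l * (u.choose l : ℚ) * (n.choose (q + 1 - l) : ℚ) := by
    rw [Finset.sum_range_succ, hq, ← Finset.sum_add_distrib]
    simp only [zero_mul, add_zero]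
    refine Finset.sum_congr rfl fun l hl => ?_
    have hl' : q + 1 - l = (q - l) + 1 := by
      have := Finset.mem_range.mp hl
      omega
    rw [hl', Nat.choose_succ_succ']
    push_cast
    ring
  have h2 : ∑ l ∈ Finset.range (q + 2),
        f l * ((u + 1).choose l : ℚ) * (n.choose (q + 1 - l) : ℚ) =
      ∑ l ∈ Finset.range (q + 1), f (l + 1) * (u.choose l : ℚ) * (n.choose (q - l) : ℚ) +
      ∑ l ∈ Finset.range (q + 1),
        f (l + 1) * (u.choose (l + 1) : ℚ) * (n.choose (q - l) : ℚ) := by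
    rw [Finset.sum_range_succ', h0, ← Finset.sum_add_distrib]
    simp only [zero_mul, add_zero]
    refine Finset.sum_congr rfl fun l _ => ?_
    rw [Nat.add_sub_add_right, Nat.choose_succ_succ']
    push_cast
    ring
  have h3 : ∑ l ∈ Finset.range (q + 1),
        f (l + 1) * (u.choose (l + 1) : ℚ) * (n.choose (q - l) : ℚ) =
      ∑ l ∈ Finset.range (q + 1), f l * (u.choose l : ℚ) * (n.choose (q + 1 - l) : ℚ) := by
    have h := Finset.sum_range_succ
      (fun l => f l * (u.choose l : ℚ) * (n.choose (q + 1 - l) : ℚ)) (q + 1)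
    rw [Finset.sum_range_succ'] at h
    simpa [h0, hq] using h
  rw [h1, h2, h3, add_sub_add_right_eq_sub, ← Finset.sum_sub_distrib]
  exact Finset.sum_congr rfl fun l _ => by ring

/-- The weights `(Q - l) / (Q l) = 1 / l - 1 / Q` are strictly decreasing in `l ≥ 1`. -/
theorem weight_succ_lt (Q l : ℕ) (hQ : 0 < Q) (hl : 0 < l) :
    ((Q : ℚ) - ((l + 1 : ℕ) : ℚ)) / ((Q : ℚ) * ((l + 1 : ℕ) : ℚ)) <
      ((Q : ℚ) - (l : ℚ)) / ((Q : ℚ) * (l : ℚ)) := by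
  have hQ' : (0 : ℚ) < Q := by exact_mod_cast hQ
  have hl' : (0 : ℚ) < l := by exact_mod_cast hl
  push_cast
  rw [div_lt_div_iff₀ (by positivity) (by positivity)]
  nlinarith [mul_pos hQ' hQ']

/-- for positive integers `K, Q` with `Q ≤ K`, the sequence `Z_K^Q`
is strictly decreasing on `[K−Q+1, K]`. -/
theorem Z_strictly_decreasing (K Q : ℕ) (hK : 0 < K) (hQ : 0 < Q) (hQK : Q ≤ K)
    (u : ℕ) (hu1 : K - Q + 1 ≤ u) (hu2 : u ≤ K - 1) :
    Z K Q (u + 1) < Z K Q u := by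
  obtain ⟨n, rfl⟩ : ∃ n, K = u + n + 1 := ⟨K - u - 1, by omega⟩
  obtain ⟨q, rfl⟩ : ∃ q, Q = q + 1 := ⟨Q - 1, by omega⟩
  have hnq : n < q := by omega
  rw [← sub_pos, Z_eq_sum_range _ _ _ (by omega), Z_eq_sum_range _ _ _ (by omega),
    show u + n + 1 - u = n + 1 by omega, show u + n + 1 - (u + 1) = n by omega,
    sum_choose_mul_choose_sub
      (fun l => (((q + 1 : ℕ) : ℚ) - (l : ℚ)) / (((q + 1 : ℕ) : ℚ) * (l : ℚ)))
      u n q (by simp) (by simp)]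
  apply Finset.sum_pos'
  · intro l _
    rcases Nat.eq_zero_or_pos l with rfl | hl
    · simp [Nat.choose_eq_zero_of_lt hnq]
    · have := sub_pos.mpr (weight_succ_lt (q + 1) l hQ hl)
      positivity
  · refine ⟨q - n, Finset.mem_range.mpr (by omega), ?_⟩
    have hw := sub_pos.mpr (weight_succ_lt (q + 1) (q - n) hQ (by omega))
    have hu : 0 < u.choose (q - n) := Nat.choose_pos (by omega)
    have hn : 0 < n.choose (q - (q - n)) := Nat.choose_pos (by omega)
    exact mul_pos (mul_pos hw (by exact_mod_cast hu)) (by exact_mod_cast hn)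
end

section
/- Let K and Q be positive integers with Q ≤ K. Then the sequence Z_K^Q is strictly convex on [K−Q+1, K]: for every integer u with K−Q+2 ≤ u ≤ K−1, one has Z_K^Q(u+1) − Z_K^Q(u) > Z_K^Q(u) − Z_K^Q(u−1). -/
/-- The Vandermonde convolution of `choose a` and `choose b` at `n`, weighted by `f`. -/
def weightedVandermonde (f : ℕ → ℚ) (a b n : ℕ) : ℚ :=
  ∑ p ∈ Finset.HasAntidiagonal.antidiagonal n, f p.1 * (a.choose p.1 : ℚ) * (b.choose p.2 : ℚ)

theorem weightedVandermonde_succ_left (f : ℕ → ℚ) (a b n : ℕ) :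
    weightedVandermonde f (a + 1) b (n + 1) =
      weightedVandermonde f a b (n + 1) + weightedVandermonde (fun l => f (l + 1)) a b n := by
  simp only [weightedVandermonde, Finset.Nat.sum_antidiagonal_succ, Nat.choose_succ_succ,
    Nat.choose_zero_right]
  rw [add_assoc, ← Finset.sum_add_distrib]
  congr 1
  refine Finset.sum_congr rfl fun p _ => ?_
  push_cast
  ring

theorem weightedVandermonde_succ_right (f : ℕ → ℚ) (a b n : ℕ) :
    weightedVandermonde f a (b + 1) (n + 1) =
      weightedVandermonde f a b (n + 1) + weightedVandermonde f a b n := by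
  simp only [weightedVandermonde, Finset.Nat.sum_antidiagonal_succ', Nat.choose_succ_succ,
    Nat.choose_zero_right]
  rw [add_assoc, ← Finset.sum_add_distrib]
  congr 1
  refine Finset.sum_congr rfl fun p _ => ?_
  push_cast
  ring

/-- Moving one element from the right to the left block takes the forward difference of the
weight. -/
theorem weightedVandermonde_sub (f : ℕ → ℚ) (a b n : ℕ) :
    weightedVandermonde f (a + 1) b (n + 1) - weightedVandermonde f a (b + 1) (n + 1) =
      weightedVandermonde (fun l => f (l + 1) - f l) a b n := by
  rw [weightedVandermonde_succ_left, weightedVandermonde_succ_right, add_sub_add_left_eq_sub]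
  simp only [weightedVandermonde, ← Finset.sum_sub_distrib]
  exact Finset.sum_congr rfl fun p _ => by ring

theorem weightedVandermonde_pos {f : ℕ → ℚ} {a b n : ℕ} (hf : ∀ l, 0 < l → 0 < f l)
    (hb : b < n) (hn : n ≤ a + b) : 0 < weightedVandermonde f a b n := by
  refine Finset.sum_pos' (fun p hp => ?_) ⟨(n - b, b), ?_, ?_⟩
  · rw [Finset.HasAntidiagonal.mem_antidiagonal] at hp
    rcases Nat.eq_zero_or_pos p.1 with h | h
    · rw [Nat.choose_eq_zero_of_lt (show b < p.2 by omega)]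
      simp
    · have := hf _ h
      positivity
  · rw [Finset.HasAntidiagonal.mem_antidiagonal]
    omega
  · have h₁ := hf (n - b) (by omega)
    have h₂ : 0 < a.choose (n - b) := Nat.choose_pos (by omega)
    simp only [Nat.choose_self, Nat.cast_one, mul_one]
    positivity

theorem Z_eq_weightedVandermonde (Q a b : ℕ) :
    Z (a + b) Q a =
      weightedVandermonde (fun l => ((Q : ℚ) - (l : ℚ)) / ((Q : ℚ) * (l : ℚ))) a b Q := by
  rw [weightedVandermonde, Finset.Nat.sum_antidiagonal_eq_sum_range_succ_mk, Z,
    Nat.add_sub_cancel_left]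
  refine Finset.sum_subset (fun l hl => ?_) fun l hl hl' => ?_
  · simp only [Finset.mem_Icc, Finset.mem_range] at *
    omega
  · simp only [Finset.mem_Icc, Finset.mem_range] at *
    rcases lt_or_ge a l with h | h
    · simp [Nat.choose_eq_zero_of_lt h]
    · simp [Nat.choose_eq_zero_of_lt (show b < Q - l by omega)]

/-- for positive integers `K, Q` with `Q ≤ K`, the sequence `Z_K^Q`
is strictly convex on `[K−Q+1, K]`: for `K−Q+2 ≤ u ≤ K−1`,
`Z_K^Q(u+1) − Z_K^Q(u) > Z_K^Q(u) − Z_K^Q(u−1)`. -/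
theorem Z_strictly_convex (K Q : ℕ) (hK : 0 < K) (hQ : 0 < Q) (hQK : Q ≤ K)
    (u : ℕ) (hu1 : K - Q + 2 ≤ u) (hu2 : u ≤ K - 1) :
    Z K Q u - Z K Q (u - 1) < Z K Q (u + 1) - Z K Q u := by
  obtain ⟨a, rfl⟩ : ∃ a, u = a + 1 := ⟨u - 1, by omega⟩
  obtain ⟨b, rfl⟩ : ∃ b, K = a + b + 2 := ⟨K - a - 2, by omega⟩
  obtain ⟨n, rfl⟩ : ∃ n, Q = n + 2 := ⟨Q - 2, by omega⟩
  have h₀ := Z_eq_weightedVandermonde (n + 2) a (b + 2)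
  have h₁ := Z_eq_weightedVandermonde (n + 2) (a + 1) (b + 1)
  have h₂ := Z_eq_weightedVandermonde (n + 2) (a + 2) b
  rw [show a + (b + 2) = a + b + 2 by ring] at h₀
  rw [show a + 1 + (b + 1) = a + b + 2 by ring] at h₁
  rw [show a + 2 + b = a + b + 2 by ring] at h₂
  rw [Nat.add_sub_cancel, h₀, h₁, h₂, weightedVandermonde_sub, weightedVandermonde_sub,
    ← sub_pos, weightedVandermonde_sub]
  refine weightedVandermonde_pos (fun l hl => ?_) (by omega) (by omega)
  have hl' : (0 : ℚ) < l := by exact_mod_cast hl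
  have key : (((n + 2 : ℕ) : ℚ) - ((l + 1 + 1 : ℕ) : ℚ)) /
        (((n + 2 : ℕ) : ℚ) * ((l + 1 + 1 : ℕ) : ℚ))
      - (((n + 2 : ℕ) : ℚ) - ((l + 1 : ℕ) : ℚ)) / (((n + 2 : ℕ) : ℚ) * ((l + 1 : ℕ) : ℚ))
      - ((((n + 2 : ℕ) : ℚ) - ((l + 1 : ℕ) : ℚ)) / (((n + 2 : ℕ) : ℚ) * ((l + 1 : ℕ) : ℚ))
        - (((n + 2 : ℕ) : ℚ) - (l : ℚ)) / (((n + 2 : ℕ) : ℚ) * (l : ℚ)))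
      = 2 / ((l : ℚ) * (l + 1) * (l + 1 + 1)) := by
    push_cast
    field_simp
    ring
  rw [key]
  positivity
end

section
/- Let K and Q be positive integers with Q ≤ K. For every integer u with K−Q+1 ≤ u ≤ K−1, the first difference of Z_K^Q has the closed form Z_K^Q(u+1) − Z_K^Q(u) = − ∑_{l=u+Q−K}^{min(u,Q−1)} C(u,l)·C(K−u−1,Q−l−1) / (l·(l+1)), as an identity of rational numbers. -/
/-- A sum over `[a, min u b]` may be extended to `[a, b]` when the summand vanishes beyond `u`. -/
theorem sum_Icc_min_eq_sum_Ico (a b u : ℕ) (f : ℕ → ℚ) (hf : ∀ l, u < l → f l = 0) :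
    ∑ l ∈ Finset.Icc a (min u b), f l = ∑ l ∈ Finset.Ico a (b + 1), f l := by
  apply Finset.sum_subset
  · intro l hl
    simp only [Finset.mem_Icc, Finset.mem_Ico] at hl ⊢
    omega
  · intro l hl hl'
    simp only [Finset.mem_Icc, Finset.mem_Ico] at hl hl'
    exact hf l (by omega)

/-- In `Z` the summand at `l = Q` vanishes, and so do those with `l > u`. -/
theorem Z_eq_sum_Ico (K Q u : ℕ) (h : u ≤ K) :
    Z K Q u = ∑ l ∈ Finset.Ico (u + Q - K) Q,
      (((Q : ℚ) - (l : ℚ)) / ((Q : ℚ) * (l : ℚ))) * (u.choose l : ℚ) *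
        ((K - u).choose (Q - l) : ℚ) := by
  rw [Z, sum_Icc_min_eq_sum_Ico, Finset.sum_Ico_succ_top (by omega)]
  · simp
  · intro l hl
    simp [Nat.choose_eq_zero_of_lt hl]

/-- closed form of the first difference of `Z_K^Q`:
for `K−Q+1 ≤ u ≤ K−1`,
`Z_K^Q(u+1) − Z_K^Q(u) = − ∑_{l=u+Q−K}^{min(u,Q−1)} C(u,l)·C(K−u−1,Q−l−1)/(l(l+1))`. -/
theorem Z_first_difference (K Q : ℕ) (hK : 0 < K) (hQ : 0 < Q) (hQK : Q ≤ K)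
    (u : ℕ) (hu1 : K - Q + 1 ≤ u) (hu2 : u ≤ K - 1) :
    Z K Q (u + 1) - Z K Q u =
      - ∑ l ∈ Finset.Icc (u + Q - K) (min u (Q - 1)),
          ((u.choose l : ℚ) * ((K - u - 1).choose (Q - l - 1) : ℚ)) /
            ((l : ℚ) * ((l : ℚ) + 1)) := by
  obtain ⟨m, rfl⟩ : ∃ m, K = u + m + 1 := ⟨K - u - 1, by omega⟩
  obtain ⟨a, rfl⟩ : ∃ a, Q = a + m + 1 := ⟨Q - m - 1, by omega⟩
  have ha : 0 < a := by omega
  rw [Z_eq_sum_Ico _ _ _ (by omega), Z_eq_sum_Ico _ _ _ (by omega), sum_Icc_min_eq_sum_Ico]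
  swap
  · intro l hl
    simp [Nat.choose_eq_zero_of_lt hl]
  rw [show u + 1 + (a + m + 1) - (u + m + 1) = a + 1 by omega,
    show u + (a + m + 1) - (u + m + 1) = a by omega,
    show u + m + 1 - (u + 1) = m by omega, show u + m + 1 - u - 1 = m by omega,
    show u + m + 1 - u = m + 1 by omega, show a + m + 1 - 1 + 1 = a + m + 1 by omega]
  set Q := a + m + 1 with hQdef
  have hQ0 : (Q : ℚ) ≠ 0 := by positivity
  -- Adjoin the vanishing summand at `l = Q` so that the first sum can be shifted to `[a, Q)`.
  have hshift : ∑ l ∈ Finset.Ico (a + 1) Q,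
      (((Q : ℚ) - (l : ℚ)) / ((Q : ℚ) * (l : ℚ))) * ((u + 1).choose l : ℚ) *
        (m.choose (Q - l) : ℚ) =
      ∑ l ∈ Finset.Ico a Q,
        (((Q : ℚ) - ((l + 1 : ℕ) : ℚ)) / ((Q : ℚ) * ((l + 1 : ℕ) : ℚ))) *
          ((u + 1).choose (l + 1) : ℚ) * (m.choose (Q - (l + 1)) : ℚ) := by
    rw [Finset.sum_Ico_add' (fun l : ℕ => (((Q : ℚ) - (l : ℚ)) / ((Q : ℚ) * (l : ℚ))) *
      ((u + 1).choose l : ℚ) * (m.choose (Q - l) : ℚ)) a Q 1,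
      Finset.sum_Ico_succ_top (b := Q) (by omega)]
    simp
  let g : ℕ → ℚ := fun l => (((Q : ℚ) - (l : ℚ)) / ((Q : ℚ) * (l : ℚ))) * (u.choose l : ℚ) *
    (m.choose (Q - l) : ℚ)
  have htel : ∑ l ∈ Finset.Ico a Q, (g (l + 1) - g l) = 0 := by
    rw [Finset.sum_Ico_sub g (by omega)]
    have hga : m.choose (Q - a) = 0 := Nat.choose_eq_zero_of_lt (by omega)
    simp [g, hga]
  rw [hshift, ← Finset.sum_sub_distrib, ← sub_zero (∑ l ∈ _, _), ← htel,
    ← Finset.sum_sub_distrib, ← Finset.sum_neg_distrib]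
  refine Finset.sum_congr rfl fun l hl => ?_
  rw [Finset.mem_Ico] at hl
  obtain ⟨r, hr⟩ : ∃ r, Q = l + r + 1 := ⟨Q - l - 1, by omega⟩
  have hl0 : (l : ℚ) ≠ 0 := by
    have : l ≠ 0 := by omega
    exact_mod_cast this
  have hl1 : (l : ℚ) + 1 ≠ 0 := by positivity
  simp only [g]
  rw [show Q - (l + 1) = r by omega, show Q - l - 1 = r by omega, show Q - l = r + 1 by omega,
    Nat.choose_succ_succ u l, Nat.choose_succ_succ m r]
  push_cast
  field_simp
  ring
end

section
/- Let K and Q be integers with 3 ≤ Q ≤ K. Then the sequence U_K^Q is strictly decreasing on [2, K]: for every integer u with 2 ≤ u ≤ K−1, one has U_K^Q(u+1) < U_K^Q(u). -/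
/-- The rational sequence `U_K^Q(u)` from the paper:
`U_K^Q(u) = C(K−u, Q−1) + ∑_{l=max(1, u−K+Q−1)}^{min(u,Q)−1} (1/l)·C(u−1,l)·C(K−u,Q−l−1)`. -/
def U (K Q u : ℕ) : ℚ :=
  ((K - u).choose (Q - 1) : ℚ) +
    ∑ l ∈ Finset.Icc (max 1 (u + Q - K - 1)) (min u Q - 1),
      (1 / (l : ℚ)) * ((u - 1).choose l : ℚ) * ((K - u).choose (Q - l - 1) : ℚ)

/-- The sum defining `U` can be taken over a range independent of `u`: the extra terms vanish. -/
lemma U_eq_sum_range (a b m : ℕ) :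
    U (a + 1 + b) (m + 2) (a + 1) = (b.choose (m + 1) : ℚ) +
      ∑ l ∈ Finset.range (m + 1),
        (1 / ((l : ℚ) + 1)) * (a.choose (l + 1) : ℚ) * (b.choose (m - l) : ℚ) := by
  have hshift : ∑ l ∈ Finset.range (m + 1),
        (1 / ((l : ℚ) + 1)) * (a.choose (l + 1) : ℚ) * (b.choose (m - l) : ℚ) =
      ∑ l ∈ Finset.Icc 1 (m + 1),
        (1 / (l : ℚ)) * (a.choose l : ℚ) * (b.choose (m + 2 - l - 1) : ℚ) := by
    rw [← Finset.Ico_add_one_right_eq_Icc, Finset.sum_Ico_eq_sum_range]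
    refine Finset.sum_congr (by simp) fun l _ => ?_
    rw [show m + 2 - (1 + l) - 1 = m - l by omega, add_comm 1 l]
    push_cast
    rfl
  rw [hshift]
  simp only [U, Nat.add_sub_cancel_left, Nat.add_sub_cancel, show m + 2 - 1 = m + 1 by omega]
  congr 1
  refine Finset.sum_subset (fun l hl => ?_) fun l hl hl' => ?_
  · simp only [Finset.mem_Icc] at hl ⊢
    omega
  · simp only [Finset.mem_Icc] at hl hl'
    rcases lt_or_ge a l with hal | hal
    · simp [Nat.choose_eq_zero_of_lt hal]
    · rw [Nat.choose_eq_zero_of_lt (show b < m + 2 - l - 1 by omega)]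
      simp

/-- The consecutive difference of `U` as a sum of nonnegative terms. -/
lemma U_sub_U_succ (a c m : ℕ) :
    U (a + 1 + (c + 1)) (m + 2) (a + 1) - U (a + 1 + (c + 1)) (m + 2) (a + 2) =
      ∑ l ∈ Finset.range m, (1 / ((l : ℚ) + 1) - 1 / ((l : ℚ) + 2)) *
        (a.choose (l + 1) : ℚ) * (c.choose (m - 1 - l) : ℚ) := by
  have hU := U_eq_sum_range (a + 1) c m
  rw [show a + 1 + 1 + c = a + 1 + (c + 1) by omega] at hU
  rw [U_eq_sum_range a (c + 1) m, hU]
  have hleft : ∑ l ∈ Finset.range (m + 1),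
        (1 / ((l : ℚ) + 1)) * (a.choose (l + 1) : ℚ) * ((c + 1).choose (m - l) : ℚ) =
      ∑ l ∈ Finset.range (m + 1),
        (1 / ((l : ℚ) + 1)) * (a.choose (l + 1) : ℚ) * (c.choose (m - l) : ℚ) +
      ∑ l ∈ Finset.range m,
        (1 / ((l : ℚ) + 1)) * (a.choose (l + 1) : ℚ) * (c.choose (m - 1 - l) : ℚ) := by
    rw [Finset.sum_range_succ, Finset.sum_range_succ _ m, add_right_comm,
      ← Finset.sum_add_distrib]
    congr 1
    · refine Finset.sum_congr rfl fun l hl => ?_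
      have hl := Finset.mem_range.mp hl
      rw [show m - l = (m - 1 - l) + 1 by omega, Nat.choose_succ_succ']
      push_cast
      ring
    · simp
  have hright : ∑ l ∈ Finset.range (m + 1),
        (1 / ((l : ℚ) + 1)) * ((a + 1).choose (l + 1) : ℚ) * (c.choose (m - l) : ℚ) =
      ∑ l ∈ Finset.range (m + 1),
        (1 / ((l : ℚ) + 1)) * (a.choose (l + 1) : ℚ) * (c.choose (m - l) : ℚ) +
      (∑ l ∈ Finset.range m,
        (1 / ((l : ℚ) + 2)) * (a.choose (l + 1) : ℚ) * (c.choose (m - 1 - l) : ℚ) +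
      (c.choose m : ℚ)) := by
    have hsucc : ∑ l ∈ Finset.range (m + 1),
          (1 / ((l : ℚ) + 1)) * (a.choose l : ℚ) * (c.choose (m - l) : ℚ) =
        ∑ l ∈ Finset.range m,
          (1 / ((l : ℚ) + 2)) * (a.choose (l + 1) : ℚ) * (c.choose (m - 1 - l) : ℚ) +
        (c.choose m : ℚ) := by
      rw [Finset.sum_range_succ']
      congr 1
      · refine Finset.sum_congr rfl fun l _ => ?_
        rw [show m - (l + 1) = m - 1 - l by omega]
        push_cast
        ring
      · simp
    rw [← hsucc, ← Finset.sum_add_distrib]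
    refine Finset.sum_congr rfl fun l _ => ?_
    rw [Nat.choose_succ_succ']
    push_cast
    ring
  rw [hleft, hright, Nat.choose_succ_succ']
  simp only [sub_mul, Finset.sum_sub_distrib]
  push_cast
  ring

/-- for integers `3 ≤ Q ≤ K`, the sequence `U_K^Q` is strictly
decreasing on `[2, K]`. -/
theorem U_strictly_decreasing (K Q : ℕ) (hQ3 : 3 ≤ Q) (hQK : Q ≤ K)
    (u : ℕ) (hu1 : 2 ≤ u) (hu2 : u ≤ K - 1) :
    U K Q (u + 1) < U K Q u := by
  obtain ⟨a, rfl⟩ : ∃ a, u = a + 1 := ⟨u - 1, by omega⟩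
  obtain ⟨c, rfl⟩ : ∃ c, K = a + 1 + (c + 1) := ⟨K - a - 2, by omega⟩
  obtain ⟨m, rfl⟩ : ∃ m, Q = m + 2 := ⟨Q - 2, by omega⟩
  rw [← sub_pos, U_sub_U_succ a c m]
  have hcoeff (l : ℕ) : 0 < 1 / ((l : ℚ) + 1) - 1 / ((l : ℚ) + 2) :=
    sub_pos.mpr (one_div_lt_one_div_of_lt (by positivity) (by linarith))
  refine Finset.sum_pos' (fun l _ => ?_) ⟨m - 1 - c, Finset.mem_range.mpr (by omega), ?_⟩
  · exact mul_nonneg (mul_nonneg (hcoeff l).le (Nat.cast_nonneg _)) (Nat.cast_nonneg _)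
  · exact mul_pos (mul_pos (hcoeff _) (Nat.cast_pos.mpr (Nat.choose_pos (by omega))))
      (Nat.cast_pos.mpr (Nat.choose_pos (by omega)))
end

section
/- Let K, F, T, S, g be positive integers with 2 ≤ g ≤ K. If A is a g-regular (K, F, T, S) placement delivery array in which every row contains exactly g−1 star entries, then F ≥ C(K, g−1). -/
/-- `A` is a placement delivery array (PDA): `A` is an `F × K` array whose entries are
either a star (`none`) or an ordinary symbol (`some s` with `s : Fin S`); every ordinary
symbol occurs at least once; and whenever two distinct entries carry the same ordinary
symbol `s`, they lie in distinct rows and columns and the two "opposite corner" entries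
are stars. -/
def IsPDA {F K S : ℕ} (A : Fin F → Fin K → Option (Fin S)) : Prop :=
  (∀ s : Fin S, ∃ j k, A j k = some s) ∧
  ∀ (j₁ j₂ : Fin F) (k₁ k₂ : Fin K) (s : Fin S),
    A j₁ k₁ = some s → A j₂ k₂ = some s → (j₁, k₁) ≠ (j₂, k₂) →
      j₁ ≠ j₂ ∧ k₁ ≠ k₂ ∧ A j₁ k₂ = none ∧ A j₂ k₁ = none

/-- Number of occurrences of the ordinary symbol `s` in the array `A`. -/
def occ {F K S : ℕ} (A : Fin F → Fin K → Option (Fin S)) (s : Fin S) : ℕ :=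
  (Finset.univ.filter fun p : Fin F × Fin K => A p.1 p.2 = some s).card

open Finset in
/-- A nonempty uniform family of finite sets that is closed under exchanging a member's element
for an outside element contains every finite set of the common size. -/
theorem mem_of_exchange_closed {α : Type*} [DecidableEq α] {n : ℕ} {P : Finset α → Prop}
    (hcard : ∀ B, P B → B.card = n)
    (hexch : ∀ B, P B → ∀ b ∈ B, ∀ k ∉ B, P ((insert k B).erase b))
    {B₀ : Finset α} (hB₀ : P B₀) {X : Finset α} (hX : X.card = n) : P X := by
  suffices h : ∀ m B, P B → (X \ B).card = m → P X from h _ B₀ hB₀ rfl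
  intro m
  induction m with
  | zero =>
    intro B hB hm
    have hsub : X ⊆ B := sdiff_eq_empty_iff_subset.mp (card_eq_zero.mp hm)
    rwa [eq_of_subset_of_card_le hsub (by rw [hX, hcard B hB])]
  | succ m ih =>
    intro B hB hm
    obtain ⟨k, hk⟩ : (X \ B).Nonempty := card_pos.mp (by omega)
    have hcomm : (B \ X).card = (X \ B).card :=
      card_sdiff_comm ((hcard B hB).trans hX.symm)
    obtain ⟨b, hb⟩ : (B \ X).Nonempty := card_pos.mp (by omega)
    rw [mem_sdiff] at hb
    refine ih _ (hexch B hB b hb.1 k (mem_sdiff.mp hk).2) ?_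
    have hdiff : X \ (insert k B).erase b = (X \ B).erase k := by
      ext x
      simp only [mem_sdiff, mem_erase, mem_insert]
      grind
    rw [hdiff, card_erase_of_mem hk, hm, Nat.add_sub_cancel]

open Finset in
/-- The columns in which row `j` of the array `A` has a star. -/
def rowStars {F K S : ℕ} (A : Fin F → Fin K → Option (Fin S)) (j : Fin F) : Finset (Fin K) :=
  univ.filter fun k => A j k = none

open Finset in
/-- The columns in which the symbol `s` occurs. -/
def symbolColumns {F K S : ℕ} (A : Fin F → Fin K → Option (Fin S)) (s : Fin S) :
    Finset (Fin K) :=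
  (univ.filter fun p : Fin F × Fin K => A p.1 p.2 = some s).image Prod.snd

theorem IsPDA.card_symbolColumns {F K S : ℕ} {A : Fin F → Fin K → Option (Fin S)}
    (hA : IsPDA A) (s : Fin S) : (symbolColumns A s).card = occ A s := by
  refine Finset.card_image_of_injOn fun p hp q hq hpq => ?_
  simp only [Finset.coe_filter, Finset.mem_univ, true_and, Set.mem_ofPred_eq] at hp hq
  by_contra hne
  exact (hA.2 p.1 q.1 p.2 q.2 s hp hq hne).2.1 hpq

/-- If the number of stars in a row is one less than the number of occurrences of a symbol appearing in
that row, then the stars are exactly in the other columns of the symbol. -/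
theorem IsPDA.rowStars_eq {F K S : ℕ} {A : Fin F → Fin K → Option (Fin S)} (hA : IsPDA A)
    {j : Fin F} {k : Fin K} {s : Fin S} (hs : A j k = some s)
    (hcard : (rowStars A j).card = occ A s - 1) :
    rowStars A j = (symbolColumns A s).erase k := by
  have hk : k ∈ symbolColumns A s :=
    Finset.mem_image.mpr ⟨(j, k), by simpa using hs, rfl⟩
  refine (Finset.eq_of_subset_of_card_le (fun c hc => ?_) ?_).symm
  · obtain ⟨hck, hc⟩ := Finset.mem_erase.mp hc
    obtain ⟨⟨i, c'⟩, hp, rfl⟩ := Finset.mem_image.mp hc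
    have hp : A i c' = some s := by simpa using hp
    have hne : (j, k) ≠ (i, c') := fun h => hck (Prod.ext_iff.mp h).2.symm
    simpa [rowStars] using (hA.2 j i k c' s hs hp hne).2.2.1
  · rw [Finset.card_erase_of_mem hk, hA.card_symbolColumns, hcard]

/-- In a regular array with one star per row fewer than the regularity, the star sets of the rows
are closed under exchange. -/
theorem IsPDA.exists_rowStars_exchange {F K S g : ℕ} {A : Fin F → Fin K → Option (Fin S)}
    (hA : IsPDA A) (hreg : ∀ s, occ A s = g) (hrow : ∀ j, (rowStars A j).card = g - 1)
    {j : Fin F} {b k : Fin K} (hb : b ∈ rowStars A j) (hk : k ∉ rowStars A j) :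
    ∃ i, rowStars A i = (insert k (rowStars A j)).erase b := by
  obtain ⟨s, hs⟩ : ∃ s, A j k = some s :=
    Option.ne_none_iff_exists'.mp (by simpa [rowStars] using hk)
  have hj := hA.rowStars_eq hs (by rw [hrow, hreg])
  have hkmem : k ∈ symbolColumns A s :=
    Finset.mem_image.mpr ⟨(j, k), by simpa using hs, rfl⟩
  have hbmem : b ∈ symbolColumns A s := Finset.mem_of_mem_erase (hj ▸ hb)
  obtain ⟨⟨i, b'⟩, hp, rfl⟩ := Finset.mem_image.mp hbmem
  have hp : A i b' = some s := by simpa using hp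
  exact ⟨i, by rw [hj, Finset.insert_erase hkmem, hA.rowStars_eq hp (by rw [hrow, hreg])]⟩

/-- if `A` is a `g`-regular `(K, F, T, S)` PDA (with `K, F, T, S, g`
positive and `2 ≤ g ≤ K`) in which every row contains exactly `g−1` star entries,
then `F ≥ C(K, g−1)`. -/
theorem pda_regular_file_lower_bound (K F T S g : ℕ)
    (hK : 0 < K) (hF : 0 < F) (hT : 0 < T) (hS : 0 < S)
    (hg2 : 2 ≤ g) (hgK : g ≤ K)
    (A : Fin F → Fin K → Option (Fin S))
    (hA : IsPDA A)
    (hstars : (Finset.univ.filter fun p : Fin F × Fin K => A p.1 p.2 = none).card = T)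
    (hreg : ∀ s : Fin S, occ A s = g)
    (hrow : ∀ j : Fin F,
      (Finset.univ.filter fun k : Fin K => A j k = none).card = g - 1) :
    K.choose (g - 1) ≤ F := by
  have hsub : Finset.powersetCard (g - 1) Finset.univ ⊆ Finset.univ.image (rowStars A) := by
    intro X hX
    have hmem : ∃ i, rowStars A i = X :=
      mem_of_exchange_closed (P := fun B => ∃ i, rowStars A i = B)
        (by rintro _ ⟨i, rfl⟩; exact hrow i)
        (by rintro _ ⟨i, rfl⟩ b hb k hk; exact hA.exists_rowStars_exchange hreg hrow hb hk)
        ⟨⟨0, hF⟩, rfl⟩ (Finset.mem_powersetCard.mp hX).2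
    simpa using hmem
  simpa using (Finset.card_le_card hsub).trans Finset.card_image_le
end

section
/- Let K and i be integers with 1 ≤ i ≤ K−1. Consider the array P_i whose rows are indexed by the i-element subsets T of {1,…,K} and whose columns are indexed by k ∈ {1,…,K}, with entry equal to '*' if k ∈ T, and equal to the ordinary symbol T ∪ {k} (an (i+1)-element subset of {1,…,K}) if k ∉ T. Then P_i is a placement delivery array with C(K,i) rows, K columns, exactly K·C(K−1,i−1) star entries in total, exactly C(K,i+1) distinct ordinary symbols each occurring exactly i+1 times (i.e., P_i is (i+1)-regular), and exactly i star entries in each row. -/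
/-- The Maddah-Ali–Niesen array `P_i`: rows are indexed by the `i`-element subsets `T`
of `{1,…,K}` (encoded as the subtype of `Finset (Fin K)` of cardinality `i`), columns
by `k ∈ {1,…,K}`; the entry is a star (`none`) if `k ∈ T`, and the ordinary symbol
`T ∪ {k}` otherwise. -/
def manPDA (K i : ℕ) (T : {T : Finset (Fin K) // T.card = i}) (k : Fin K) :
    Option (Finset (Fin K)) :=
  if k ∈ T.1 then none else some (insert k T.1)

theorem manPDA_eq_none_iff {K i : ℕ} {T : {T : Finset (Fin K) // T.card = i}} {k : Fin K} :
    manPDA K i T k = none ↔ k ∈ T.1 := by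
  simp [manPDA]

theorem manPDA_eq_some_iff {K i : ℕ} {T : {T : Finset (Fin K) // T.card = i}} {k : Fin K}
    {s : Finset (Fin K)} :
    manPDA K i T k = some s ↔ k ∈ s ∧ T.1 = s.erase k := by
  unfold manPDA
  split_ifs with h
  · simp only [false_iff, not_and]
    rintro - hT
    simp [hT] at h
  · rw [Option.some_inj]
    constructor
    · rintro rfl
      simp [h]
    · rintro ⟨hk, hT⟩
      rw [hT, Finset.insert_erase hk]

theorem exists_manPDA_eq_some_iff {K i : ℕ} {s : Finset (Fin K)} :
    (∃ (T : {T : Finset (Fin K) // T.card = i}) (k : Fin K), manPDA K i T k = some s) ↔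
      s.card = i + 1 := by
  simp only [manPDA_eq_some_iff]
  constructor
  · rintro ⟨T, k, hk, hT⟩
    rw [← Finset.card_erase_add_one hk, ← hT, T.2]
  · intro hs
    obtain ⟨k, hk⟩ : s.Nonempty := Finset.card_pos.mp (by omega)
    exact ⟨⟨s.erase k, by rw [Finset.card_erase_of_mem hk, hs, Nat.add_sub_cancel]⟩, k, hk, rfl⟩

theorem card_filter_manPDA_eq_some {K i : ℕ} {s : Finset (Fin K)} (hs : s.card = i + 1) :
    (Finset.univ.filter fun p : {T : Finset (Fin K) // T.card = i} × Fin K =>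
      manPDA K i p.1 p.2 = some s).card = i + 1 := by
  rw [← hs]
  refine Finset.card_bij (fun p _ => p.2) ?_ ?_ ?_
  · intro p hp
    exact (manPDA_eq_some_iff.mp (Finset.mem_filter.mp hp).2).1
  · rintro ⟨T₁, k₁⟩ h₁ ⟨T₂, k₂⟩ h₂ (rfl : k₁ = k₂)
    simp only [Finset.mem_filter, Finset.mem_univ, true_and, manPDA_eq_some_iff] at h₁ h₂
    exact Prod.ext (Subtype.ext (h₁.2.trans h₂.2.symm)) rfl
  · intro k hk
    refine ⟨(⟨s.erase k, by rw [Finset.card_erase_of_mem hk, hs, Nat.add_sub_cancel]⟩, k), ?_, rfl⟩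
    simp [manPDA_eq_some_iff, hk]

theorem card_filter_manPDA_eq_none {K i : ℕ} (T : {T : Finset (Fin K) // T.card = i}) :
    (Finset.univ.filter fun k : Fin K => manPDA K i T k = none).card = i := by
  simp [manPDA_eq_none_iff, T.2]

/-- for `1 ≤ i ≤ K−1`, the array `P_i` is a placement delivery array
with `C(K,i)` rows, `K` columns, exactly `K·C(K−1,i−1)` star entries in total,
exactly `C(K,i+1)` distinct ordinary symbols each occurring exactly `i+1` times
(i.e. `P_i` is `(i+1)`-regular), and exactly `i` star entries in each row. -/
theorem manPDA_is_PDA (K i : ℕ) (hi1 : 1 ≤ i) (hi2 : i ≤ K - 1) :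
    -- the defining property of a PDA
    (∀ (T₁ T₂ : {T : Finset (Fin K) // T.card = i}) (k₁ k₂ : Fin K)
        (s : Finset (Fin K)),
        manPDA K i T₁ k₁ = some s → manPDA K i T₂ k₂ = some s →
        (T₁, k₁) ≠ (T₂, k₂) →
        T₁ ≠ T₂ ∧ k₁ ≠ k₂ ∧ manPDA K i T₁ k₂ = none ∧ manPDA K i T₂ k₁ = none) ∧
    -- number of rows is C(K, i)
    Fintype.card {T : Finset (Fin K) // T.card = i} = K.choose i ∧
    -- total number of star entries is K·C(K−1, i−1)
    (Finset.univ.filter fun p : {T : Finset (Fin K) // T.card = i} × Fin K =>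
        manPDA K i p.1 p.2 = none).card = K * (K - 1).choose (i - 1) ∧
    -- exactly C(K, i+1) distinct ordinary symbols occur
    (Finset.univ.filter fun s : Finset (Fin K) =>
        ∃ (T : {T : Finset (Fin K) // T.card = i}) (k : Fin K),
          manPDA K i T k = some s).card = K.choose (i + 1) ∧
    -- every occurring ordinary symbol occurs exactly i+1 times
    (∀ s : Finset (Fin K),
        (∃ (T : {T : Finset (Fin K) // T.card = i}) (k : Fin K),
            manPDA K i T k = some s) →
        (Finset.univ.filter fun p : {T : Finset (Fin K) // T.card = i} × Fin K =>
            manPDA K i p.1 p.2 = some s).card = i + 1) ∧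
    -- every row contains exactly i star entries
    (∀ T : {T : Finset (Fin K) // T.card = i},
        (Finset.univ.filter fun k : Fin K => manPDA K i T k = none).card = i) := by
  have hrows : Fintype.card {T : Finset (Fin K) // T.card = i} = K.choose i := by
    simp
  refine ⟨?_, hrows, ?_, ?_, ?_, card_filter_manPDA_eq_none⟩
  · intro T₁ T₂ k₁ k₂ s h₁ h₂ hne
    rw [manPDA_eq_some_iff] at h₁ h₂
    have hk : k₁ ≠ k₂ := by
      rintro rfl
      exact hne (Prod.ext (Subtype.ext (h₁.2.trans h₂.2.symm)) rfl)
    have hk₂ : k₂ ∈ T₁.1 := by simp [h₁.2, h₂.1, hk.symm]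
    have hk₁ : k₁ ∈ T₂.1 := by simp [h₂.2, h₁.1, hk]
    refine ⟨?_, hk, manPDA_eq_none_iff.mpr hk₂, manPDA_eq_none_iff.mpr hk₁⟩
    rintro rfl
    simp [h₁.2] at hk₁
  · obtain ⟨j, rfl⟩ : ∃ j, i = j + 1 := ⟨i - 1, by omega⟩
    obtain ⟨n, rfl⟩ : ∃ n, K = n + 1 := ⟨K - 1, by omega⟩
    rw [Finset.card_filter, Fintype.sum_prod_type]
    simp only [← Finset.card_filter, card_filter_manPDA_eq_none, Finset.sum_const,
      Finset.card_univ, hrows, smul_eq_mul, Nat.add_sub_cancel]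
    exact (Nat.add_one_mul_choose_eq n j).symm
  · simp only [exists_manPDA_eq_some_iff]
    rw [← Fintype.card_subtype]
    simp
  · intro s hs
    exact card_filter_manPDA_eq_some (exists_manPDA_eq_some_iff.mp hs)
end

section
/- Let K, Q, g be integers with 1 ≤ Q ≤ K and 1 ≤ g ≤ K. Then, as an identity of rational numbers, C(g,1)·C(K−g, Q−1) + ∑_{l=2}^{Q} (l/(l−1))·C(g,l)·C(K−g, Q−l) = g·( C(K−g, Q−1) + ∑_{l=1}^{Q−1} (1/l)·C(g−1,l)·C(K−g, Q−l−1) ), where C(n,k) denotes the binomial coefficient (equal to 0 when k < 0 or k > n). -/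
/-- for integers `1 ≤ Q ≤ K` and `1 ≤ g ≤ K`, as rational numbers,
`C(g,1)·C(K−g, Q−1) + ∑_{l=2}^{Q} (l/(l−1))·C(g,l)·C(K−g, Q−l)
  = g·( C(K−g, Q−1) + ∑_{l=1}^{Q−1} (1/l)·C(g−1,l)·C(K−g, Q−l−1) )`. -/
theorem binomial_weighted_identity (K Q g : ℕ)
    (hQ1 : 1 ≤ Q) (hQK : Q ≤ K) (hg1 : 1 ≤ g) (hgK : g ≤ K) :
    (g.choose 1 : ℚ) * ((K - g).choose (Q - 1) : ℚ) +
        ∑ l ∈ Finset.Icc 2 Q,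
          ((l : ℚ) / ((l : ℚ) - 1)) * (g.choose l : ℚ) * ((K - g).choose (Q - l) : ℚ)
      = (g : ℚ) * (((K - g).choose (Q - 1) : ℚ) +
          ∑ l ∈ Finset.Icc 1 (Q - 1),
            (1 / (l : ℚ)) * ((g - 1).choose l : ℚ) *
              ((K - g).choose (Q - l - 1) : ℚ)) := by
  obtain ⟨n, rfl⟩ := Nat.exists_eq_add_of_le' hg1
  obtain ⟨q, rfl⟩ := Nat.exists_eq_add_of_le' hQ1
  rw [mul_add, Nat.choose_one_right, Finset.mul_sum]
  congr 1
  refine Finset.sum_nbij' (· - 1) (· + 1) ?_ ?_ ?_ ?_ ?_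
  · intro l hl
    simp only [Finset.mem_Icc] at hl ⊢
    omega
  · intro l hl
    simp only [Finset.mem_Icc] at hl ⊢
    omega
  · intro l hl
    simp only [Finset.mem_Icc] at hl
    omega
  · intro l _
    simp
  · intro l hl
    simp only [Finset.mem_Icc] at hl
    obtain ⟨m, rfl⟩ := Nat.exists_eq_add_of_le' (show 1 ≤ l by omega)
    have hm : (m : ℚ) ≠ 0 := Nat.cast_ne_zero.mpr (by omega)
    have absorption : ((n : ℚ) + 1) * n.choose m = (n + 1).choose (m + 1) * (m + 1) :=
      mod_cast Nat.add_one_mul_choose_eq n m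
    simp only [Nat.add_sub_cancel, Nat.sub_sub, Nat.add_sub_add_right]
    push_cast
    rw [add_sub_cancel_right]
    field_simp
    linear_combination (-((K - (n + 1)).choose (q - m) : ℚ)) * absorption
end

section
/- Let K, Q, r be integers with 1 ≤ Q ≤ K and K−Q+1 ≤ r ≤ K. Then, as an identity of rational numbers, (1/C(K,Q)) · ∑_{l=r+Q−K}^{min(r,Q)} ((Q−l)/(Q·l))·C(r,l)·C(K−r, Q−l) = (1 − r/K) · (1/C(K−1, Q−1)) · ∑_{l=r+Q−K}^{min(r, Q−1)} (1/l)·C(r,l)·C(K−r−1, Q−l−1), where C(n,k) denotes the binomial coefficient (equal to 0 when k < 0 or k > n). -/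
/-- The absorption identity `n * C(n-1, k-1) = k * C(n, k)`, also valid at `n = 0`. -/
theorem Nat.mul_choose_pred_pred (n : ℕ) {k : ℕ} (hk : 0 < k) :
    n * (n - 1).choose (k - 1) = k * n.choose k := by
  obtain ⟨k, rfl⟩ := Nat.exists_eq_succ_of_ne_zero hk.ne'
  cases n with
  | zero => simp
  | succ n => simpa [mul_comm] using Nat.add_one_mul_choose_eq n k

/-- for integers `1 ≤ Q ≤ K` and `K−Q+1 ≤ r ≤ K`, as rational numbers,
`(1/C(K,Q)) · ∑_{l=r+Q−K}^{min(r,Q)} ((Q−l)/(Q·l))·C(r,l)·C(K−r, Q−l)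
  = (1 − r/K)·(1/C(K−1, Q−1))·∑_{l=r+Q−K}^{min(r, Q−1)} (1/l)·C(r,l)·C(K−r−1, Q−l−1)`. -/
theorem converse_load_identity (K Q r : ℕ)
    (hQ1 : 1 ≤ Q) (hQK : Q ≤ K) (hr1 : K - Q + 1 ≤ r) (hr2 : r ≤ K) :
    (1 / (K.choose Q : ℚ)) *
        ∑ l ∈ Finset.Icc (r + Q - K) (min r Q),
          (((Q : ℚ) - (l : ℚ)) / ((Q : ℚ) * (l : ℚ))) * (r.choose l : ℚ) *
            ((K - r).choose (Q - l) : ℚ)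
      = (1 - (r : ℚ) / (K : ℚ)) * (1 / ((K - 1).choose (Q - 1) : ℚ)) *
          ∑ l ∈ Finset.Icc (r + Q - K) (min r (Q - 1)),
            (1 / (l : ℚ)) * (r.choose l : ℚ) *
              ((K - r - 1).choose (Q - l - 1) : ℚ) := by
  have hK : (K : ℚ) ≠ 0 := by exact_mod_cast (by omega : K ≠ 0)
  have hQ : (Q : ℚ) ≠ 0 := by exact_mod_cast (by omega : Q ≠ 0)
  have hC : (K.choose Q : ℚ) ≠ 0 := by exact_mod_cast (Nat.choose_pos hQK).ne'
  have hC' : ((K - 1).choose (Q - 1) : ℚ) ≠ 0 := by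
    exact_mod_cast (Nat.choose_pos (by omega : Q - 1 ≤ K - 1)).ne'
  have hKQ : (K : ℚ) * ((K - 1).choose (Q - 1) : ℚ) = Q * (K.choose Q : ℚ) := by
    exact_mod_cast Nat.mul_choose_pred_pred K hQ1
  have hsub : Finset.Icc (r + Q - K) (min r (Q - 1)) ⊆ Finset.Icc (r + Q - K) (min r Q) :=
    Finset.Icc_subset_Icc_right (by omega)
  rw [← Finset.sum_subset hsub, Finset.mul_sum, Finset.mul_sum]
  · refine Finset.sum_congr rfl fun l hl => ?_
    rw [Finset.mem_Icc] at hl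
    have hl0 : (l : ℚ) ≠ 0 := by exact_mod_cast (by omega : l ≠ 0)
    have habs : ((K : ℚ) - r) * ((K - r - 1).choose (Q - l - 1) : ℚ) =
        ((Q : ℚ) - l) * ((K - r).choose (Q - l) : ℚ) := by
      rw [← Nat.cast_sub hr2, ← Nat.cast_sub (by omega : l ≤ Q)]
      exact_mod_cast Nat.mul_choose_pred_pred (K - r) (by omega : 0 < Q - l)
    calc _ = (((Q : ℚ) - l) * ((K - r).choose (Q - l) : ℚ)) * (r.choose l : ℚ) /
            (l * (Q * (K.choose Q : ℚ))) := by field_simp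
      _ = _ := by
        rw [← habs, ← hKQ]
        field_simp
  · intro l hl hl'
    rw [Finset.mem_Icc] at hl hl'
    obtain rfl : l = Q := by omega
    simp
end

section
/- Let K, Q, r be integers with 1 ≤ Q ≤ K and K−Q+1 ≤ r ≤ K−1 (so in particular r ≥ 1). Then U_K^Q(r) ≤ (1 + 2/r) · U_K^Q(r+1). -/
/-- Outside the summation range in the definition of `U` the binomial coefficients vanish. -/
theorem U_eq_sum_range_s17 (K q u : ℕ) (hu : 1 ≤ u) (huK : u ≤ K) :
    U K (q + 1) u = ((K - u).choose q : ℚ) +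
      ∑ i ∈ Finset.range q,
        (1 / ((i : ℚ) + 1)) * ((u - 1).choose (i + 1) : ℚ) * ((K - u).choose (q - (i + 1)) : ℚ) := by
  have hshift : ∑ i ∈ Finset.range q,
      (1 / ((i : ℚ) + 1)) * ((u - 1).choose (i + 1) : ℚ) * ((K - u).choose (q - (i + 1)) : ℚ) =
      ∑ l ∈ Finset.Ico 1 (q + 1),
        (1 / (l : ℚ)) * ((u - 1).choose l : ℚ) * ((K - u).choose (q + 1 - l - 1) : ℚ) := by
    rw [Finset.sum_Ico_eq_sum_range]
    refine Finset.sum_congr (by simp) fun i _ => ?_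
    rw [show q + 1 - (1 + i) - 1 = q - (i + 1) by omega, add_comm 1 i]
    push_cast
    rfl
  rw [U, hshift, Nat.add_sub_cancel]
  congr 1
  refine Finset.sum_subset ?_ ?_
  · intro l hl
    simp only [Finset.mem_Icc, Finset.mem_Ico] at hl ⊢
    omega
  · intro l hl hl'
    simp only [Finset.mem_Icc, Finset.mem_Ico] at hl hl'
    rcases Nat.lt_or_ge (u - 1) l with h | h
    · simp [Nat.choose_eq_zero_of_lt h]
    · have h' : K - u < q + 1 - l - 1 := by omega
      simp [Nat.choose_eq_zero_of_lt h']

theorem choose_div_add_choose_div_le (s i : ℕ) :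
    (1 / ((i : ℚ) + 2)) * (s.choose (i + 2) : ℚ) + (1 / ((i : ℚ) + 1)) * (s.choose (i + 1) : ℚ) ≤
      (1 + 2 / ((s : ℚ) + 1)) * ((1 / ((i : ℚ) + 2)) * ((s + 1).choose (i + 2) : ℚ)) := by
  have habsorb : ((s : ℚ) + 1) * (s.choose (i + 1) : ℚ) =
      ((s + 1).choose (i + 2) : ℚ) * ((i : ℚ) + 2) := by
    have := Nat.add_one_mul_choose_eq s (i + 1)
    have h2 : ((s : ℚ) + 1) * (s.choose (i + 1) : ℚ) =
      ((s + 1).choose (i + 2) : ℚ) * ((i : ℚ) + 1 + 1) := by exact_mod_cast this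
    linear_combination h2
  have hpascal : ((s + 1).choose (i + 2) : ℚ) = s.choose (i + 1) + s.choose (i + 2) := by
    exact_mod_cast Nat.choose_succ_succ s (i + 1)
  have hy : (0 : ℚ) ≤ s.choose (i + 1) := Nat.cast_nonneg _
  have hquot : ((s + 1).choose (i + 2) : ℚ) / ((s : ℚ) + 1) =
      s.choose (i + 1) / ((i : ℚ) + 2) := by
    rw [div_eq_div_iff (by positivity) (by positivity)]
    linear_combination -habsorb
  have hdiff : (1 + 2 / ((s : ℚ) + 1)) * ((1 / ((i : ℚ) + 2)) * ((s + 1).choose (i + 2) : ℚ)) -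
      ((1 / ((i : ℚ) + 2)) * (s.choose (i + 2) : ℚ) +
        (1 / ((i : ℚ) + 1)) * (s.choose (i + 1) : ℚ)) =
      (s.choose (i + 1) : ℚ) * i / (((i : ℚ) + 1) * ((i : ℚ) + 2) ^ 2) := by
    calc _ = (1 / ((i : ℚ) + 2)) * ((s + 1).choose (i + 2) : ℚ) +
          2 / ((i : ℚ) + 2) * (((s + 1).choose (i + 2) : ℚ) / ((s : ℚ) + 1)) -
          ((1 / ((i : ℚ) + 2)) * (s.choose (i + 2) : ℚ) +
            (1 / ((i : ℚ) + 1)) * (s.choose (i + 1) : ℚ)) := by ring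
      _ = _ := by
        rw [hquot, hpascal]
        field_simp
        ring
  have hnonneg : (0 : ℚ) ≤
      (s.choose (i + 1) : ℚ) * i / (((i : ℚ) + 1) * ((i : ℚ) + 2) ^ 2) := by positivity
  linarith

/-- Pascal's rule in the second binomial factor, collecting the terms by their value of
`N.choose (p - i)`. -/
theorem sum_choose_pascal (f : ℕ → ℚ) (N p : ℕ) :
    ∑ i ∈ Finset.range (p + 1), f i * ((N + 1).choose (p - i) : ℚ) =
      f 0 * (N.choose p : ℚ) +
        ∑ i ∈ Finset.range p, (f (i + 1) + f i) * (N.choose (p - (i + 1)) : ℚ) := by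
  have hterm : ∀ i ∈ Finset.range p, f i * ((N + 1).choose (p - i) : ℚ) =
      f i * (N.choose (p - i) : ℚ) + f i * (N.choose (p - (i + 1)) : ℚ) := by
    intro i hi
    obtain ⟨m, hm⟩ : ∃ m, p - i = m + 1 :=
      ⟨p - i - 1, by have := Finset.mem_range.mp hi; omega⟩
    rw [show p - (i + 1) = m by omega, hm, Nat.choose_succ_succ]
    push_cast
    ring
  have hsplit := (Finset.sum_range_succ (fun i => f i * (N.choose (p - i) : ℚ)) p).symm.trans
    (Finset.sum_range_succ' _ p)
  rw [Finset.sum_range_succ, Finset.sum_congr rfl hterm, Finset.sum_add_distrib]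
  simp only [add_mul, Finset.sum_add_distrib, Nat.sub_self, Nat.choose_zero_right,
    Nat.sub_zero] at hsplit ⊢
  linarith

/-- for integers `1 ≤ Q ≤ K` and `K−Q+1 ≤ r ≤ K−1`,
`U_K^Q(r) ≤ (1 + 2/r) · U_K^Q(r+1)`. -/
theorem U_ratio_bound (K Q r : ℕ) (hQ1 : 1 ≤ Q) (hQK : Q ≤ K)
    (hr1 : K - Q + 1 ≤ r) (hr2 : r ≤ K - 1) :
    U K Q r ≤ (1 + 2 / (r : ℚ)) * U K Q (r + 1) := by
  obtain ⟨p, rfl⟩ : ∃ p, Q = p + 1 + 1 := ⟨Q - 2, by omega⟩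
  obtain ⟨s, rfl⟩ : ∃ s, r = s + 1 := ⟨r - 1, by omega⟩
  obtain ⟨N, rfl⟩ : ∃ N, K = s + 1 + 1 + N := ⟨K - (s + 2), by omega⟩
  have hNp : N < p + 1 := by omega
  rw [U_eq_sum_range_s17 _ _ _ (by omega) (by omega), U_eq_sum_range_s17 _ _ _ (by omega) (by omega)]
  simp only [show s + 1 + 1 + N - (s + 1) = N + 1 by omega,
    show s + 1 + 1 + N - (s + 1 + 1) = N by omega, Nat.add_sub_cancel, Nat.add_sub_add_right]
  rw [sum_choose_pascal (fun i => 1 / ((i : ℚ) + 1) * (s.choose (i + 1) : ℚ)),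
    Finset.sum_range_succ', Nat.choose_succ_succ, Nat.choose_eq_zero_of_lt hNp]
  have hsum : ∑ i ∈ Finset.range p, (1 / (((i + 1 : ℕ) : ℚ) + 1) * (s.choose (i + 1 + 1) : ℚ) +
        1 / ((i : ℚ) + 1) * (s.choose (i + 1) : ℚ)) * (N.choose (p - (i + 1)) : ℚ) ≤
      (1 + 2 / ((s + 1 : ℕ) : ℚ)) * ∑ i ∈ Finset.range p,
        1 / (((i + 1 : ℕ) : ℚ) + 1) * ((s + 1).choose (i + 1 + 1) : ℚ) *
          (N.choose (p - (i + 1)) : ℚ) := by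
    rw [Finset.mul_sum]
    refine Finset.sum_le_sum fun i _ => ?_
    rw [← mul_assoc]
    refine mul_le_mul_of_nonneg_right ?_ (Nat.cast_nonneg _)
    have h := choose_div_add_choose_div_le s i
    rw [show (i : ℚ) + 2 = ((i + 1 : ℕ) : ℚ) + 1 by push_cast; ring] at h
    exact_mod_cast h
  have hfirst : (0 : ℚ) ≤ 2 / ((s + 1 : ℕ) : ℚ) * (((s : ℚ) + 1) * (N.choose p : ℚ)) := by
    positivity
  simp only [Nat.choose_one_right, Nat.sub_zero, zero_add, Nat.cast_zero, add_zero, div_one,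
    one_mul, mul_add]
  push_cast at hsum hfirst ⊢
  linarith
end
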